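/- The infinite series identity $\sum_{k=0}^{\infty}\frac{(1)_k}{(3/2)_k(1+2k)}\Big\{H_{1+2k}^{(2)}-\frac{1}{4}H_{k}^{(2)}\Big\} = 2\beta(4)$ holds. -/

import Mathlib

open scoped BigOperators

/-- The shifted factorial (Pochhammer symbol) `(x)_n = x (x+1) ⋯ (x+n-1)`. -/
noncomputable def poch (x : ℝ) (n : ℕ) : ℝ := ∏ i ∈ Finset.range n, (x + i)

/-- The harmonic numbers of order 2, `H_n^{(2)} = ∑_{j=1}^n 1/j²`. -/
noncomputable def H2 (n : ℕ) : ℝ := ∑ j ∈ Finset.range n, 1 / ((j : ℝ) + 1) ^ 2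

/-- The Dirichlet beta value `β(4) = ∑_{k≥0} (-1)^k/(1+2k)⁴`. -/
noncomputable def beta4 : ℝ := ∑' k : ℕ, (-1) ^ k / (1 + 2 * (k : ℝ)) ^ 4

/-- The Catalan constant `G = ∑_{k≥0} (-1)^k/(1+2k)²`. -/
noncomputable def catalanG : ℝ := ∑' k : ℕ, (-1) ^ k / (1 + 2 * (k : ℝ)) ^ 2

theorem choose_succ_mul_cast (n m : ℕ) :
    (n.choose (m + 1) : ℝ) * (m + 1) = n.choose m * ((n : ℝ) - m) := by
  rcases le_or_gt m n with h | h
  · rw [← Nat.cast_sub h]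
    exact_mod_cast Nat.choose_succ_right_eq n m
  · simp [Nat.choose_eq_zero_of_lt h, Nat.choose_eq_zero_of_lt (h.trans (Nat.lt_succ_self m))]

/-- Twice the probability that the simple random walk first hits `2 * j + 1` at time
`2 * k + 1`. -/
noncomputable def hitting (k j : ℕ) : ℝ :=
  (2 * j + 1) / (2 * k + 1) * ((2 * k + 1).choose (k + j + 1) / 4 ^ k)

theorem hitting_nonneg (k j : ℕ) : 0 ≤ hitting k j := by
  unfold hitting; positivity

theorem hitting_eq_zero {k j : ℕ} (h : k < j) : hitting k j = 0 := by
  simp [hitting, Nat.choose_eq_zero_of_lt (show 2 * k + 1 < k + j + 1 by omega)]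

/-- The ballot form of `hitting`. -/
theorem hitting_eq_sub (k j : ℕ) :
    hitting k j = (((2 * k).choose (k + j) : ℝ) - (2 * k).choose (k + j + 1)) / 4 ^ k := by
  have h := choose_succ_mul_cast (2 * k) (k + j)
  have hk : (2 * (k : ℝ) + 1) ≠ 0 := by positivity
  rw [hitting, Nat.choose_succ_succ]
  push_cast at h ⊢
  field_simp
  linear_combination 2 * h

/-- Twice the probability that the walk has not hit `2 * j + 1` before time `2 * k + 1`. -/
noncomputable def hittingTail (j k : ℕ) : ℝ :=
  2 * (((2 * k).choose k : ℝ) / 4 ^ k) +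
    4 * ∑ i ∈ Finset.range j, ((2 * k).choose (k + i + 1) : ℝ) / 4 ^ k

theorem hittingTail_zero (j : ℕ) : hittingTail j 0 = 2 := by
  simp [hittingTail]

theorem choose_two_mul_add_two (k m : ℕ) :
    ((2 * (k + 1)).choose (m + 2) : ℝ) =
      (2 * k).choose m + 2 * (2 * k).choose (m + 1) + (2 * k).choose (m + 2) := by
  rw [show 2 * (k + 1) = 2 * k + 1 + 1 by ring, Nat.choose_succ_succ, Nat.choose_succ_succ,
    Nat.choose_succ_succ (2 * k) (m + 1)]
  push_cast
  ring

theorem hittingTail_sub_succ (j k : ℕ) :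
    hittingTail j k - hittingTail j (k + 1) = hitting k j := by
  induction j with
  | zero =>
    have h := Nat.succ_mul_centralBinom_succ k
    have h' := choose_succ_mul_cast (2 * k) k
    rw [Nat.centralBinom, Nat.centralBinom] at h
    have h : ((k : ℝ) + 1) * (2 * (k + 1)).choose (k + 1) = 2 * (2 * k + 1) * (2 * k).choose k := by
      exact_mod_cast h
    rw [hitting_eq_sub]
    simp only [hittingTail, Finset.range_zero, Finset.sum_empty, pow_succ]
    push_cast at h' ⊢
    have hk : (k : ℝ) + 1 ≠ 0 := by positivity
    field_simp
    apply mul_left_cancel₀ hk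
    linear_combination -2 * h + 4 * h'
  | succ j ih =>
    have pascal := choose_two_mul_add_two k (k + j)
    have step : 4 * (((2 * k).choose (k + j + 1) : ℝ) / 4 ^ k) -
        4 * (((2 * (k + 1)).choose (k + 1 + j + 1) : ℝ) / 4 ^ (k + 1)) =
        hitting k (j + 1) - hitting k j := by
      rw [hitting_eq_sub, hitting_eq_sub, show k + 1 + j + 1 = k + j + 2 by ring, pascal,
        show k + (j + 1) = k + j + 1 by ring, pow_succ]
      field_simp
      ring
    simp only [hittingTail, Finset.sum_range_succ] at ih ⊢
    linear_combination ih + step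

theorem tendsto_centralBinom_div :
    Filter.Tendsto (fun k : ℕ => ((2 * k).choose k : ℝ) / 4 ^ k) Filter.atTop (nhds 0) := by
  have bound (k : ℕ) : (((2 * k).choose k : ℝ) / 4 ^ k) ^ 2 ≤ 1 / ((k : ℝ) + 1) := by
    induction k with
    | zero => simp
    | succ k ih =>
      have h := Nat.succ_mul_centralBinom_succ k
      rw [Nat.centralBinom, Nat.centralBinom] at h
      have h : ((k : ℝ) + 1) * (2 * (k + 1)).choose (k + 1) =
          2 * (2 * k + 1) * (2 * k).choose k := by
        exact_mod_cast h
      have ratio : ((2 * (k + 1)).choose (k + 1) : ℝ) / 4 ^ (k + 1) =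
          (2 * k + 1) / (2 * (k + 1)) * ((2 * k).choose k / 4 ^ k) := by
        rw [pow_succ]
        field_simp
        linear_combination 2 * h
      rw [ratio, mul_pow]
      refine (mul_le_mul_of_nonneg_left ih (by positivity)).trans ?_
      push_cast
      rw [div_pow, div_mul_div_comm, div_le_div_iff₀ (by positivity) (by positivity)]
      nlinarith [(Nat.cast_nonneg k : (0 : ℝ) ≤ k)]
  have sq_tendsto := squeeze_zero (fun k => sq_nonneg _) bound
    tendsto_one_div_add_atTop_nhds_zero_nat
  have := sq_tendsto.sqrt
  rw [Real.sqrt_zero] at this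
  exact this.congr fun k => Real.sqrt_sq (by positivity)

theorem tendsto_hittingTail (j : ℕ) :
    Filter.Tendsto (hittingTail j) Filter.atTop (nhds 0) := by
  have h (i : ℕ) : Filter.Tendsto (fun k : ℕ => ((2 * k).choose (k + i + 1) : ℝ) / 4 ^ k)
      Filter.atTop (nhds 0) := by
    refine squeeze_zero (fun k => by positivity) (fun k => ?_) tendsto_centralBinom_div
    gcongr
    exact Nat.choose_le_centralBinom _ k
  have := (tendsto_centralBinom_div.const_mul 2).add
    ((tendsto_finsetSum (Finset.range j) fun i _ => h i).const_mul 4)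
  rw [Finset.sum_const_zero, mul_zero, mul_zero, add_zero] at this
  exact this

theorem hasSum_hitting (j : ℕ) : HasSum (fun k => hitting k j) 2 := by
  rw [hasSum_iff_tendsto_nat_of_nonneg fun k => hitting_nonneg k j]
  have h (n : ℕ) : ∑ k ∈ Finset.range n, hitting k j = 2 - hittingTail j n := by
    simp_rw [← hittingTail_sub_succ]
    rw [Finset.sum_range_sub', hittingTail_zero]
  simp_rw [h]
  simpa using (tendsto_hittingTail j).const_sub 2

theorem hitting_succ (k j : ℕ) :
    ((2 * (k : ℝ) + 3) ^ 2 - (2 * j + 1) ^ 2) * hitting (k + 1) j =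
      2 * (k + 1) * (2 * k + 1) * hitting k j := by
  have h₁ := choose_succ_mul_cast (2 * k + 1) (k + j)
  have h₂ : (2 * (k : ℝ) + 3) * (2 * k + 2).choose (k + j + 1) =
      (2 * k + 3).choose (k + j + 2) * (k + j + 2) := by
    exact_mod_cast Nat.add_one_mul_choose_eq (2 * k + 2) (k + j + 1)
  rw [Nat.choose_succ_succ (2 * k + 1)] at h₂
  rw [hitting, hitting, show 2 * (k + 1) + 1 = 2 * k + 3 by ring,
    show k + 1 + j + 1 = k + j + 2 by ring, pow_succ]
  push_cast at h₁ h₂ ⊢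
  rw [show 2 * ((k : ℝ) + 1) + 1 = 2 * k + 3 by ring]
  field_simp
  linear_combination
    4 ^ k * ((-4 * ((k : ℝ) + 1 - j)) * h₂ - 4 * (2 * (k : ℝ) + 3) * h₁)

/-- The alternating moments of `hitting k`. -/
noncomputable def altMoment (s k : ℕ) : ℝ :=
  ∑ j ∈ Finset.range (k + 1), (-1) ^ j * hitting k j / (2 * (j : ℝ) + 1) ^ s

theorem altMoment_zero_succ (k : ℕ) : altMoment 0 (k + 1) = 0 := by
  have partialSum (n : ℕ) : ∑ j ∈ Finset.range n, (-1) ^ j * (hitting (k + 1) j * 4 ^ (k + 1)) =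
      (-1) ^ (n + 1) *
        (((2 * k + 1).choose (k + n) : ℝ) - (2 * k + 1).choose (k + n + 1)) := by
    induction n with
    | zero =>
      have := Nat.choose_symm_half k
      simp [this]
    | succ n ih =>
      rw [Finset.sum_range_succ, ih, hitting_eq_sub, show 2 * (k + 1) = 2 * k + 1 + 1 by ring,
        show k + 1 + n = k + n + 1 by ring, Nat.choose_succ_succ (2 * k + 1),
        Nat.choose_succ_succ (2 * k + 1), show k + (n + 1) = k + n + 1 by ring]
      push_cast
      field_simp
      ring
  have h := partialSum (k + 1 + 1)
  rw [Nat.choose_eq_zero_of_lt (by omega), Nat.choose_eq_zero_of_lt (by omega)] at h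
  simp_rw [← mul_assoc] at h
  rw [← Finset.sum_mul] at h
  simpa [altMoment] using h

theorem altMoment_succ (s k : ℕ) :
    (2 * (k : ℝ) + 3) ^ 2 * altMoment (s + 2) (k + 1) =
      altMoment s (k + 1) + 2 * (k + 1) * (2 * k + 1) * altMoment (s + 2) k := by
  have h : altMoment (s + 2) k = ∑ j ∈ Finset.range (k + 1 + 1),
      (-1) ^ j * hitting k j / (2 * (j : ℝ) + 1) ^ (s + 2) := by
    rw [Finset.sum_range_succ, hitting_eq_zero (Nat.lt_succ_self k)]
    simp [altMoment]
  rw [h, altMoment, altMoment, Finset.mul_sum, Finset.mul_sum, ← Finset.sum_add_distrib]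
  refine Finset.sum_congr rfl fun j _ => ?_
  have hj : (2 * (j : ℝ) + 1) ≠ 0 := by positivity
  rw [pow_add]
  field_simp
  linear_combination hitting_succ k j

theorem altMoment_base (s : ℕ) : altMoment s 0 = 1 := by
  simp [altMoment, hitting]

theorem poch_succ (x : ℝ) (n : ℕ) : poch x (n + 1) = poch x n * (x + n) :=
  Finset.prod_range_succ _ _

theorem poch_pos {x : ℝ} (hx : 0 < x) (n : ℕ) : 0 < poch x n :=
  Finset.prod_pos fun _ _ => by positivity

/-- The coefficient of the series. -/
noncomputable def coeff (k : ℕ) : ℝ := poch 1 k / (poch (3 / 2) k * (1 + 2 * (k : ℝ)))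

theorem coeff_succ (k : ℕ) :
    (2 * (k : ℝ) + 3) ^ 2 * coeff (k + 1) = 2 * (k + 1) * (2 * k + 1) * coeff k := by
  have h := (poch_pos (show (0 : ℝ) < 3 / 2 by norm_num) k).ne'
  have h₁ : (1 + 2 * (k : ℝ)) ≠ 0 := by positivity
  have h₂ : (3 + 2 * (k : ℝ)) ≠ 0 := by positivity
  have h₃ : (1 + 2 * ((k : ℝ) + 1)) ≠ 0 := by positivity
  have h₄ : (3 / 2 + (k : ℝ)) ≠ 0 := by positivity
  rw [coeff, coeff, poch_succ, poch_succ]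
  push_cast
  field_simp
  ring

theorem altMoment_two (k : ℕ) : altMoment 2 k = coeff k := by
  induction k with
  | zero => simp [altMoment_base, coeff, poch]
  | succ k ih =>
    have h := altMoment_succ 0 k
    rw [altMoment_zero_succ, zero_add, zero_add, ih, ← coeff_succ] at h
    exact mul_left_cancel₀ (by positivity) h

theorem H2_succ (n : ℕ) : H2 (n + 1) = H2 n + 1 / ((n : ℝ) + 1) ^ 2 :=
  Finset.sum_range_succ _ _

theorem altMoment_four (k : ℕ) :
    altMoment 4 k = coeff k * (H2 (1 + 2 * k) - 1 / 4 * H2 k) := by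
  induction k with
  | zero => simp [altMoment_base, coeff, poch, H2]
  | succ k ih =>
    have h := altMoment_succ 2 k
    have hc := coeff_succ k
    rw [altMoment_two, ih] at h
    have hk : (2 * (k : ℝ) + 3) ≠ 0 := by positivity
    have hH : H2 (1 + 2 * (k + 1)) - 1 / 4 * H2 (k + 1) =
        H2 (1 + 2 * k) - 1 / 4 * H2 k + 1 / (2 * (k : ℝ) + 3) ^ 2 := by
      rw [show 1 + 2 * (k + 1) = 1 + 2 * k + 1 + 1 by ring, H2_succ, H2_succ, H2_succ]
      push_cast
      have h₁ : (1 + 2 * (k : ℝ) + 1) = 2 * (k + 1) := by ring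
      have h₂ : (1 + 2 * (k : ℝ) + 1 + 1) = 2 * k + 3 := by ring
      rw [h₂, h₁]
      field_simp
      ring
    rw [hH]
    apply mul_left_cancel₀ (pow_ne_zero 2 hk)
    rw [h]
    have hinv := mul_one_div_cancel (pow_ne_zero 2 hk)
    linear_combination (-(H2 (1 + 2 * k) - 1 / 4 * H2 k)) * hc - coeff (k + 1) * hinv

theorem summable_hitting :
    Summable (Function.uncurry fun j k : ℕ =>
      (-1) ^ j * hitting k j / (2 * (j : ℝ) + 1) ^ 4) := by
  have norm_eq (j k : ℕ) : ‖(-1) ^ j * hitting k j / (2 * (j : ℝ) + 1) ^ 4‖ =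
      hitting k j / (2 * (j : ℝ) + 1) ^ 4 := by
    rw [norm_div, norm_mul, norm_pow, norm_neg, norm_one, one_pow, one_mul,
      Real.norm_of_nonneg (hitting_nonneg k j), Real.norm_of_nonneg (by positivity)]
  apply Summable.of_norm
  rw [summable_prod_of_nonneg fun _ => norm_nonneg _]
  simp only [Function.uncurry_apply_pair, norm_eq]
  refine ⟨fun j => ((hasSum_hitting j).div_const _).summable, ?_⟩
  simp_rw [fun j : ℕ => ((hasSum_hitting j).div_const ((2 * (j : ℝ) + 1) ^ 4)).tsum_eq]
  have h := (summable_nat_add_iff 1).2 (Real.summable_one_div_nat_pow.2 (show 1 < 4 by norm_num))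
  refine Summable.of_nonneg_of_le (fun _ => by positivity) (fun j => ?_) (h.mul_left 2)
  rw [mul_one_div]
  push_cast
  gcongr
  linarith [(Nat.cast_nonneg j : (0 : ℝ) ≤ j)]

theorem stmt1 :
    (∑' k : ℕ, poch 1 k / (poch (3/2) k * (1 + 2 * (k : ℝ))) *
      (H2 (1 + 2 * k) - 1/4 * H2 k)) = 2 * beta4 := by
  calc
    _ = ∑' k : ℕ, ∑' j : ℕ, (-1) ^ j * hitting k j / (2 * (j : ℝ) + 1) ^ 4 := by
      refine tsum_congr fun k => ?_
      rw [tsum_eq_sum (s := Finset.range (k + 1)) fun j hj => by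
        rw [hitting_eq_zero (by simpa [Nat.lt_succ_iff] using hj)]; simp]
      exact (altMoment_four k).symm
    _ = ∑' j : ℕ, ∑' k : ℕ, (-1) ^ j * hitting k j / (2 * (j : ℝ) + 1) ^ 4 :=
      summable_hitting.tsum_comm
    _ = ∑' j : ℕ, 2 * ((-1) ^ j / (1 + 2 * (j : ℝ)) ^ 4) := by
      refine tsum_congr fun j => ?_
      rw [(((hasSum_hitting j).mul_left ((-1) ^ j)).div_const _).tsum_eq]
      ring
    _ = 2 * beta4 := tsum_mul_left
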